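/- arXiv:1004.2685 — 2 statements merged into one kernel-verified Lean document; each statement's English description precedes it below -/
import Mathlib

section
/- A finite simple graph G is a Hasse graph, i.e., there exists a partial order P on the vertex set of G whose covering relations are exactly the edges of G, if and only if G admits a 2-balanced orientation. -/
open Classical in
/-- Number of darts of a closed walk `c` that are oriented "forward" by the relation `r`. -/
noncomputable def fwdCount {V : Type*} {G : SimpleGraph V} {v : V}
    (r : V → V → Prop) (c : G.Walk v v) : ℕ :=
  (c.darts.filter fun d => decide (r d.toProd.1 d.toProd.2)).length

/-- A relation `r` (directing some of the edges of `G`) is `k`-balanced if along every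
cycle of `G` at least `k` edges are directed forward by `r` and at least `k` backward. -/
def KBalancedRel {V : Type*} (G : SimpleGraph V) (r : V → V → Prop) (k : ℕ) : Prop :=
  ∀ ⦃v : V⦄ (c : G.Walk v v), c.IsCycle →
    k ≤ fwdCount r c ∧ k ≤ fwdCount (fun i j => r j i) c

/-- An orientation of a simple graph `G`: for every edge `{i,j}` exactly one of
`(i,j)`, `(j,i)` is a directed edge. -/
structure GraphOrientation {V : Type*} (G : SimpleGraph V) where
  dir : V → V → Prop
  dir_adj : ∀ ⦃i j⦄, dir i j → G.Adj i j
  exactlyOne : ∀ ⦃i j⦄, G.Adj i j → (dir i j ↔ ¬ dir j i)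

/-- A `k`-balanced orientation. -/
def GraphOrientation.KBalanced {V : Type*} {G : SimpleGraph V} (O : GraphOrientation G)
    (k : ℕ) : Prop :=
  KBalancedRel G O.dir k

/-- An acyclic orientation: no directed cycles. -/
def GraphOrientation.Acyclic {V : Type*} {G : SimpleGraph V} (O : GraphOrientation G) : Prop :=
  Irreflexive (Relation.TransGen O.dir)

/-- A proper coloring of `G` by positive integers. -/
def IsProperColoring {V : Type*} (G : SimpleGraph V) (κ : V → ℕ+) : Prop :=
  ∀ ⦃i j⦄, G.Adj i j → κ i ≠ κ j

/-- A `k`-balanced coloring: a proper coloring whose induced orientation (each edge directed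
towards the larger color) is `k`-balanced. -/
def IsKBalancedColoring {V : Type*} (G : SimpleGraph V) (k : ℕ) (κ : V → ℕ+) : Prop :=
  IsProperColoring G κ ∧ KBalancedRel G (fun i j => κ i < κ j) k

/-- `χ_G^k(λ)`: the number of `k`-balanced colorings of `G` using colors from `{1,…,λ}`. -/
noncomputable def kChromCount {V : Type*} [Fintype V] (G : SimpleGraph V) (k : ℕ)
    (lam : ℕ) : ℕ :=
  Nat.card {κ : V → ℕ+ // IsKBalancedColoring G k κ ∧ ∀ v, (κ v : ℕ) ≤ lam}

theorem aux_split {V : Type*} {G : SimpleGraph V} {u w : V} (p : G.Walk u w) (d : G.Dart)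
    (hd : d ∈ p.darts) : ∃ (p1 : G.Walk u d.fst) (p2 : G.Walk d.snd w),
      p = p1.append (SimpleGraph.Walk.cons d.adj p2) := by
  induction p with
  | nil => simp at hd
  | cons h q ih =>
    rw [SimpleGraph.Walk.darts_cons, List.mem_cons] at hd
    rcases hd with rfl | hd
    · exact ⟨SimpleGraph.Walk.nil, q, rfl⟩
    · obtain ⟨p1, p2, e⟩ := ih hd
      exact ⟨SimpleGraph.Walk.cons h p1, p2, by rw [SimpleGraph.Walk.cons_append, ← e]⟩

theorem aux_back {V : Type*} {G : SimpleGraph V} (L : V → V → Prop)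
    (htr : ∀ a b c, L a b → L b c → L a c) {u w : V} (p : G.Walk u w)
    (hp : ∀ d ∈ p.darts, L d.snd d.fst) : u = w ∨ L w u := by
  induction p with
  | nil => exact Or.inl rfl
  | cons h q ih =>
    simp only [SimpleGraph.Walk.darts_cons, List.mem_cons, forall_eq_or_imp] at hp
    rcases ih hp.2 with e | e
    · subst e; exact Or.inr hp.1
    · exact Or.inr (htr _ _ _ e hp.1)

theorem aux_mid {V : Type*} {G : SimpleGraph V} (L : V → V → Prop)
    (htr : ∀ a b c, L a b → L b c → L a c) {u w : V} (q : G.Walk u w)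
    (hq : ∀ d ∈ q.darts, L d.snd d.fst) (hl2 : 2 ≤ q.length) : ∃ z, L w z ∧ L z u := by
  cases q with
  | nil => simp at hl2
  | cons h q =>
    simp only [SimpleGraph.Walk.darts_cons, List.mem_cons, forall_eq_or_imp] at hq
    cases q with
    | nil => simp at hl2
    | cons h' q =>
      have h2 := hq.2
      simp only [SimpleGraph.Walk.darts_cons, List.mem_cons, forall_eq_or_imp] at h2
      rcases aux_back L htr q h2.2 with e | e
      · exact ⟨_, e ▸ h2.1, hq.1⟩
      · exact ⟨_, htr _ _ _ e h2.1, hq.1⟩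

open Classical in
theorem aux_two {V : Type*} {G : SimpleGraph V} (r L : V → V → Prop)
    (htr : ∀ a b c, L a b → L b c → L a c) (hirr : ∀ a, ¬ L a a)
    (hrL : ∀ a b, r a b → L a b) (hcov : ∀ a z b, r a b → L a z → L z b → False)
    (hadj : ∀ a b, G.Adj a b → r a b ∨ r b a) {v : V} (c : G.Walk v v) (hc : c.IsCycle) :
    2 ≤ fwdCount r c := by
  by_contra hlt
  have hlen := hc.three_le_length
  by_cases hex : ∃ d ∈ c.darts, r d.fst d.snd
  · obtain ⟨d, hd, hr⟩ := hex
    obtain ⟨p1, p2, e⟩ := aux_split c d hd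
    subst e
    have hq : ∀ d' ∈ (p2.append p1).darts, L d'.snd d'.fst := by
      intro d' hd'
      rcases hadj _ _ d'.adj with h | h
      · exfalso
        apply hlt
        simp only [SimpleGraph.Walk.darts_append, List.mem_append] at hd'
        unfold fwdCount
        simp only [SimpleGraph.Walk.darts_append, SimpleGraph.Walk.darts_cons,
          List.filter_append, List.filter_cons, List.length_append]
        rw [if_pos (by simpa using hr)]
        have key : ∀ l : List G.Dart, d' ∈ l →
            1 ≤ (l.filter fun d => decide (r d.toProd.1 d.toProd.2)).length := by
          intro l hl
          apply List.length_pos_of_mem (a := d')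
          simpa using ⟨hl, h⟩
        rw [List.length_cons]
        rcases hd' with hd' | hd'
        · have := key _ hd'
          omega
        · have := key _ hd'
          omega
      · exact hrL _ _ h
    have hl2 : 2 ≤ (p2.append p1).length := by
      simp only [SimpleGraph.Walk.length_append, SimpleGraph.Walk.length_cons] at hlen ⊢
      omega
    obtain ⟨z, hz1, hz2⟩ := aux_mid L htr _ hq hl2
    exact hcov _ _ _ hr hz1 hz2
  · push Not at hex
    have hb : ∀ d ∈ c.darts, L d.snd d.fst := fun d hd =>
      hrL _ _ ((hadj _ _ d.adj).resolve_left (hex d hd))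
    cases c with
    | nil => simp at hlen
    | cons h q =>
      simp only [SimpleGraph.Walk.darts_cons, List.mem_cons, forall_eq_or_imp] at hb
      rcases aux_back L htr q hb.2 with e | e
      · subst e; exact hirr _ hb.1
      · exact hirr _ (htr _ _ _ e hb.1)

theorem aux_walk {V : Type*} {G : SimpleGraph V} (O : GraphOrientation G) {a b : V}
    (h : Relation.ReflTransGen O.dir a b) :
    ∃ p : G.Walk a b, ∀ d ∈ p.darts, O.dir d.fst d.snd := by
  induction h using Relation.ReflTransGen.head_induction_on with
  | refl => exact ⟨SimpleGraph.Walk.nil, by simp⟩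
  | head h _ ih =>
    obtain ⟨p, hp⟩ := ih
    refine ⟨SimpleGraph.Walk.cons (O.dir_adj h) p, ?_⟩
    simp only [SimpleGraph.Walk.darts_cons, List.mem_cons, forall_eq_or_imp]
    exact ⟨h, hp⟩

theorem aux_supp {V : Type*} {G : SimpleGraph V} (O : GraphOrientation G) {a b w : V}
    (p : G.Walk a b) (hp : ∀ d ∈ p.darts, O.dir d.fst d.snd) (hw : w ∈ p.support) :
    Relation.ReflTransGen O.dir a w ∧ Relation.ReflTransGen O.dir w b := by
  induction p generalizing w with
  | nil =>
    simp at hw; subst hw; exact ⟨.refl, .refl⟩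
  | cons h q ih =>
    simp only [SimpleGraph.Walk.darts_cons, List.mem_cons, forall_eq_or_imp] at hp
    rw [SimpleGraph.Walk.support_cons, List.mem_cons] at hw
    rcases hw with rfl | hw
    · exact ⟨.refl, .head hp.1 (ih hp.2 q.start_mem_support).2⟩
    · have := ih hp.2 hw
      exact ⟨.head hp.1 this.1, this.2⟩

theorem aux_acyc {V : Type*} {G : SimpleGraph V} (O : GraphOrientation G) (hO : O.KBalanced 2)
    {a b : V} (h : O.dir a b) (h' : Relation.ReflTransGen O.dir b a) : False := by
  classical
  obtain ⟨p, hp⟩ := aux_walk O h'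
  have hp' : ∀ d ∈ p.bypass.darts, O.dir d.fst d.snd := fun d hd =>
    hp d (p.darts_bypass_subset_darts hd)
  have hpath := p.bypass_isPath
  generalize p.bypass = q at hp' hpath
  have hcyc : (SimpleGraph.Walk.cons (O.dir_adj h) q).IsCycle := by
    rw [SimpleGraph.Walk.cons_isCycle_iff]
    refine ⟨hpath, fun he => ?_⟩
    obtain ⟨d, hd, e⟩ := List.mem_map.1 he
    rcases (SimpleGraph.dart_edge_eq_mk'_iff'.1 e) with ⟨e1, e2⟩ | ⟨e1, e2⟩
    · have hm : b ∈ q.support.tail := by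
        rw [← SimpleGraph.Walk.map_snd_darts]
        exact List.mem_map.2 ⟨d, hd, e2⟩
      have hn := hpath.support_nodup
      rw [← SimpleGraph.Walk.cons_tail_support] at hn
      exact (List.nodup_cons.1 hn).1 hm
    · have := hp' d hd
      rw [show d.fst = b from e1, show d.snd = a from e2] at this
      exact (O.exactlyOne (O.dir_adj h)).1 h this
  have h2 := (hO _ hcyc).2
  have : fwdCount (fun i j => O.dir j i) (SimpleGraph.Walk.cons (O.dir_adj h) q) = 0 := by
    unfold fwdCount
    rw [List.length_eq_zero_iff, List.filter_eq_nil_iff]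
    simp only [SimpleGraph.Walk.darts_cons, List.mem_cons, forall_eq_or_imp, decide_eq_true_eq]
    exact ⟨(O.exactlyOne (O.dir_adj h)).1 h,
      fun d hd => (O.exactlyOne d.adj).1 (hp' d hd)⟩
  omega

theorem aux_path {V : Type*} {G : SimpleGraph V} (O : GraphOrientation G) (hO : O.KBalanced 2)
    {a b : V} (p : G.Walk a b) (hp : ∀ d ∈ p.darts, O.dir d.fst d.snd) : p.IsPath := by
  induction p with
  | nil => simp
  | cons h q ih =>
    simp only [SimpleGraph.Walk.darts_cons, List.mem_cons, forall_eq_or_imp] at hp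
    rw [SimpleGraph.Walk.cons_isPath_iff]
    exact ⟨ih hp.2, fun hm => aux_acyc O hO hp.1 (aux_supp O q hp.2 hm).1⟩

open Classical in
theorem aux_cov {V : Type*} {G : SimpleGraph V} (O : GraphOrientation G) (hO : O.KBalanced 2)
    {x y z : V} (h : O.dir x y) (h1 : Relation.ReflTransGen O.dir x z)
    (h2 : Relation.ReflTransGen O.dir z y) (h1' : ¬ Relation.ReflTransGen O.dir z x)
    (h2' : ¬ Relation.ReflTransGen O.dir y z) : False := by
  obtain ⟨p1, hp1⟩ := aux_walk O h1
  obtain ⟨p2, hp2⟩ := aux_walk O h2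
  have hp : ∀ d ∈ (p1.append p2).darts, O.dir d.fst d.snd := by
    intro d hd
    rw [SimpleGraph.Walk.darts_append, List.mem_append] at hd
    exact hd.elim (hp1 d) (hp2 d)
  have hcyc : (SimpleGraph.Walk.cons (O.dir_adj h).symm (p1.append p2)).IsCycle := by
    rw [SimpleGraph.Walk.cons_isCycle_iff]
    refine ⟨aux_path O hO _ hp, fun he => ?_⟩
    rw [SimpleGraph.Walk.edges_append, List.mem_append] at he
    rcases he with he | he
    · exact h2' (aux_supp O p1 hp1 (p1.fst_mem_support_of_mem_edges he)).2
    · exact h1' (aux_supp O p2 hp2 (p2.snd_mem_support_of_mem_edges he)).1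
  have hb := (hO _ hcyc).2
  have h0 : (p1.append p2).darts.filter
      (fun d => decide (O.dir d.toProd.2 d.toProd.1)) = [] := by
    rw [List.filter_eq_nil_iff]
    intro d hd
    simpa using (O.exactlyOne d.adj).1 (hp d hd)
  have : fwdCount (fun i j => O.dir j i)
      (SimpleGraph.Walk.cons (O.dir_adj h).symm (p1.append p2)) ≤ 1 := by
    unfold fwdCount
    rw [SimpleGraph.Walk.darts_cons, List.filter_cons]
    have h0' := congrArg List.length h0
    split_ifs
    · rw [List.length_cons]
      simp only [List.length_nil] at h0'
      exact Nat.succ_le_succ (le_of_eq h0')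
    · simp only [List.length_nil] at h0'
      refine le_trans (le_of_eq ?_) (Nat.zero_le 1)
      exact h0'
  omega

/-- A finite simple graph is a Hasse graph (there is a partial order on its
vertex set whose covering relations are exactly its edges) if and only if it admits a
2-balanced orientation. -/
theorem stmt3 {V : Type*} [Fintype V] (G : SimpleGraph V) :
    (∃ P : PartialOrder V, ∀ x y : V,
        G.Adj x y ↔ (@CovBy V P.toPreorder.toLT x y ∨ @CovBy V P.toPreorder.toLT y x)) ↔
    (∃ O : GraphOrientation G, O.KBalanced 2) := by
  classical
  constructor
  · rintro ⟨P, hP⟩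
    refine ⟨⟨fun x y => x ⋖ y, fun i j h => (hP i j).2 (Or.inl h), fun i j h => ?_⟩, ?_⟩
    · constructor
      · intro h1 h2
        exact lt_asymm h1.lt h2.lt
      · intro h2
        exact ((hP i j).1 h).resolve_right h2
    · intro v c hc
      constructor
      · exact aux_two (fun x y => x ⋖ y) (fun x y => x < y) (fun _ _ _ => lt_trans)
          (fun a => lt_irrefl a) (fun _ _ h => h.lt) (fun _ _ _ h h1 h2 => h.2 h1 h2)
          (fun a b h => (hP a b).1 h) c hc
      · exact aux_two (fun x y => y ⋖ x) (fun x y => y < x) (fun _ _ _ h1 h2 => lt_trans h2 h1)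
          (fun a => lt_irrefl a) (fun _ _ h => h.lt) (fun _ _ _ h h1 h2 => h.2 h2 h1)
          (fun a b h => ((hP a b).1 h).symm) c hc
  · rintro ⟨O, hO⟩
    let P : PartialOrder V :=
      { le := Relation.ReflTransGen O.dir
        le_refl := fun _ => .refl
        le_trans := fun _ _ _ => Relation.ReflTransGen.trans
        le_antisymm := by
          intro a b h1 h2
          rcases Relation.ReflTransGen.cases_head h1 with e | ⟨c, hc, hcb⟩
          · exact e
          · exact (aux_acyc O hO hc (hcb.trans h2)).elim }
    have key : ∀ x y, O.dir x y ↔ @CovBy V P.toPreorder.toLT x y := by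
      intro x y
      constructor
      · intro h
        exact ⟨⟨.single h, fun h' => aux_acyc O hO h h'⟩, fun z h1 h2 =>
          aux_cov O hO h h1.1 h2.1 h1.2 h2.2⟩
      · rintro ⟨h1, h2⟩
        rcases Relation.ReflTransGen.cases_head h1.1 with e | ⟨c, hc, hcb⟩
        · exact (h1.2 (e ▸ .refl)).elim
        · rcases Relation.ReflTransGen.cases_head hcb with e | ⟨c', hc', hcb'⟩
          · exact e ▸ hc
          · refine (h2 (c := c) ⟨.single hc, fun h' => aux_acyc O hO hc h'⟩
              ⟨hcb, fun h' => aux_acyc O hO hc' (hcb'.trans h')⟩).elim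
    refine ⟨P, fun x y => ?_⟩
    rw [← key, ← key]
    constructor
    · intro h
      by_cases h' : O.dir y x
      · exact Or.inr h'
      · exact Or.inl ((O.exactlyOne h).2 h')
    · rintro (h | h)
      · exact O.dir_adj h
      · exact (O.dir_adj h).symm
end

section
/- Let G be a finite simple graph with n vertices, let k ≥ 2, suppose G contains at least one cycle and admits at least one k-balanced coloring, and let p be the polynomial with rational coefficients satisfying p(λ) = χ_G^k(λ) for all positive integers λ. Then p has degree n and its leading coefficient equals c/n!, where c is the number of k-balanced colorings of G that are bijections from the vertex set onto {1, …, n}; moreover 0 < c < n!, so the leading coefficient of p is not an integer. -/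
open Classical in
theorem aux_compress {V α : Type*} [Fintype V] [LinearOrder α] (g : V → α)
    (hg : Function.Injective g) :
    ∃ f : V → Fin (Fintype.card V), Function.Injective f ∧ (∀ i j, f i < f j ↔ g i < g j) ∧
      ∃ hS : (Finset.univ.image g).card = Fintype.card V,
        ∀ v, (Finset.univ.image g).orderEmbOfFin hS (f v) = g v := by
  have hS : (Finset.univ.image g).card = Fintype.card V := by
    rw [Finset.card_image_of_injective _ hg, Finset.card_univ]
  have key : ∀ i, (Finset.univ.image g).orderEmbOfFin hS
      (((Finset.univ.image g).orderIsoOfFin hS).symm ⟨g i, by simp⟩) = g i := by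
    intro i
    rw [← Finset.coe_orderIsoOfFin_apply]
    simp
  refine ⟨fun v => ((Finset.univ.image g).orderIsoOfFin hS).symm ⟨g v, by simp⟩, ?_, ?_, hS, key⟩
  · intro a b hab
    apply hg
    rw [← key a, ← key b]
    exact congrArg _ hab
  · intro i j
    simp

theorem aux_linext {V α : Type*} [Fintype V] [LinearOrder α] (h : V → α) :
    ∃ f : V → Fin (Fintype.card V), Function.Injective f ∧ ∀ i j, h i < h j → f i < f j := by
  obtain ⟨f, hf, hlt, -⟩ := aux_compress (fun v => toLex (h v, Fintype.equivFin V v)) (by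
    intro a b hab
    have := congrArg (fun x => (ofLex x).2) hab
    simpa using this)
  refine ⟨f, hf, fun i j hij => (hlt i j).2 ?_⟩
  rw [Prod.Lex.toLex_lt_toLex]
  exact Or.inl hij

def AuxBal {V α : Type*} [LinearOrder α] (G : SimpleGraph V) (k : ℕ) (f : V → α) : Prop :=
  (∀ ⦃i j⦄, G.Adj i j → f i ≠ f j) ∧ KBalancedRel G (fun i j => f i < f j) k

theorem aux_fwd_congr {V : Type*} {G : SimpleGraph V} {v : V} (r s : V → V → Prop)
    (h : ∀ i j, G.Adj i j → (r i j ↔ s i j)) (c : G.Walk v v) : fwdCount r c = fwdCount s c := by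
  unfold fwdCount
  congr 1
  apply List.filter_congr
  intro d _
  simp [h _ _ d.adj]

theorem aux_bal_congr {V α β : Type*} [LinearOrder α] [LinearOrder β] (G : SimpleGraph V) (k : ℕ)
    (f : V → α) (g : V → β) (h : ∀ i j, G.Adj i j → (f i < f j → g i < g j))
    (hf : AuxBal G k f) : AuxBal G k g := by
  have h2 : ∀ i j, G.Adj i j → (f i < f j ↔ g i < g j) := by
    intro i j hij
    refine ⟨h i j hij, fun hg => ?_⟩
    rcases lt_or_gt_of_ne (hf.1 hij) with h1 | h1
    · exact h1
    · exact absurd (h j i hij.symm h1) (not_lt.2 hg.le)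
  refine ⟨fun i j hij => ?_, fun v c hc => ?_⟩
  · rcases lt_or_gt_of_ne (hf.1 hij) with h1 | h1
    · exact (h i j hij h1).ne
    · exact (h j i hij.symm h1).ne'
  · rw [← aux_fwd_congr _ _ h2 c,
      ← aux_fwd_congr (fun i j => f j < f i) _ (fun i j hij => h2 j i hij.symm) c]
    exact hf.2 c hc

open Classical in
theorem aux_path_s12 {V : Type*} {G : SimpleGraph V} {u v : V} (p : G.Walk u v) (hp : p.IsPath) :
    ∀ d ∈ p.darts, p.support.idxOf d.fst < p.support.idxOf d.snd := by
  induction p with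
  | nil => simp
  | @cons a b c h q ih =>
    rw [SimpleGraph.Walk.cons_isPath_iff] at hp
    intro d hd
    rw [SimpleGraph.Walk.darts_cons, List.mem_cons] at hd
    rw [SimpleGraph.Walk.support_cons]
    rcases hd with rfl | hd
    · simp only [List.idxOf_cons_self]
      rw [List.idxOf_cons_ne _ h.ne]
      omega
    · have h1 := q.dart_fst_mem_support_of_mem_darts hd
      have h2 := q.dart_snd_mem_support_of_mem_darts hd
      rw [List.idxOf_cons_ne _ (fun e => hp.2 (by rw [e]; exact h1)),
        List.idxOf_cons_ne _ (fun e => hp.2 (by rw [e]; exact h2))]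
      have := ih hp.1 d hd
      omega

theorem aux_nonbal {V : Type*} [Fintype V] (G : SimpleGraph V) (k : ℕ) (hk : 2 ≤ k)
    (hcyc : ∃ (v : V) (c : G.Walk v v), c.IsCycle) :
    ∃ f : V → Fin (Fintype.card V), Function.Injective f ∧ ¬ AuxBal G k f := by
  classical
  obtain ⟨v, c, hc⟩ := hcyc
  cases c with
  | nil => exact absurd hc (by simp)
  | @cons _ u _ hadj p =>
    have hp := ((SimpleGraph.Walk.cons_isCycle_iff p hadj).1 hc).1
    obtain ⟨f, hf, hlt⟩ := aux_linext (fun x => p.support.idxOf x)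
    refine ⟨f, hf, fun hb => ?_⟩
    have h1 := (hb.2 _ hc).2
    have h0 : (p.darts.filter fun d => decide (f d.toProd.2 < f d.toProd.1)) = [] := by
      rw [List.filter_eq_nil_iff]
      intro d hd
      have := hlt _ _ (aux_path_s12 p hp d hd)
      simpa using this.le
    unfold fwdCount at h1
    rw [SimpleGraph.Walk.darts_cons, List.filter_cons] at h1
    have h0' := congrArg List.length h0
    simp only [List.length_nil] at h0'
    split_ifs at h1
    · rw [List.length_cons] at h1
      have h3 : k ≤ 0 + 1 := by
        rw [← h0']
        convert h1
      omega
    · have h3 : k ≤ 0 := by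
        rw [← h0']
        convert h1
      omega

def auxEquiv {V : Type*} (lam : ℕ) : {κ : V → ℕ+ // ∀ v, (κ v : ℕ) ≤ lam} ≃ (V → Fin lam) where
  toFun κ v := ⟨(κ.1 v : ℕ) - 1, by have := κ.2 v; have := (κ.1 v).pos; omega⟩
  invFun f := ⟨fun v => ⟨(f v : ℕ) + 1, by omega⟩, fun v => by
    have := (f v).2
    simp only [PNat.mk_coe]; omega⟩
  left_inv κ := by
    ext v
    have := (κ.1 v).pos
    apply PNat.eq
    change (κ.1 v : ℕ) - 1 + 1 = (κ.1 v : ℕ)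
    omega
  right_inv f := by
    ext v
    simp

theorem auxEquiv_lt {V : Type*} (lam : ℕ) (κ : {κ : V → ℕ+ // ∀ v, (κ v : ℕ) ≤ lam}) (i j : V) :
    auxEquiv lam κ i < auxEquiv lam κ j ↔ κ.1 i < κ.1 j := by
  have := (κ.1 i).pos
  have := (κ.1 j).pos
  rw [← PNat.coe_lt_coe, Fin.lt_def]
  simp only [auxEquiv, Equiv.coe_fn_mk]
  omega

theorem auxEquiv_bal {V : Type*} (G : SimpleGraph V) (k : ℕ) (lam : ℕ)
    (κ : {κ : V → ℕ+ // ∀ v, (κ v : ℕ) ≤ lam}) :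
    IsKBalancedColoring G k κ.1 ↔ AuxBal G k (auxEquiv lam κ) :=
  ⟨fun h => aux_bal_congr G k κ.1 _ (fun i j _ => (auxEquiv_lt lam κ i j).2) h,
   fun h => aux_bal_congr G k _ κ.1 (fun i j _ => (auxEquiv_lt lam κ i j).1) h⟩

theorem auxEquiv_inj {V : Type*} (lam : ℕ)
    (κ : {κ : V → ℕ+ // ∀ v, (κ v : ℕ) ≤ lam}) :
    Function.Injective κ.1 ↔ Function.Injective (auxEquiv lam κ) := by
  have h : ∀ i j, auxEquiv lam κ i = auxEquiv lam κ j ↔ κ.1 i = κ.1 j := by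
    intro i j
    have h1 := auxEquiv_lt lam κ i j
    have h2 := auxEquiv_lt lam κ j i
    constructor
    · intro h
      rw [h] at h1 h2
      exact le_antisymm (not_lt.1 fun h => absurd (h2.2 h) (lt_irrefl _))
        (not_lt.1 fun h => absurd (h1.2 h) (lt_irrefl _))
    · intro h
      rw [h] at h1 h2
      exact le_antisymm (not_lt.1 fun h => absurd (h2.1 h) (lt_irrefl _))
        (not_lt.1 fun h => absurd (h1.1 h) (lt_irrefl _))
  exact ⟨fun hh i j e => hh ((h i j).1 e), fun hh i j e => hh ((h i j).2 e)⟩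

open Classical in
theorem aux_card1 {V : Type*} [Fintype V] (G : SimpleGraph V) (k : ℕ) (lam : ℕ) :
    kChromCount G k lam = (Finset.univ.filter fun f : V → Fin lam => AuxBal G k f).card := by
  rw [kChromCount, ← Fintype.card_subtype, ← Nat.card_eq_fintype_card]
  apply Nat.card_congr
  refine Equiv.trans ?_ (Equiv.subtypeEquiv (auxEquiv lam) (fun κ => auxEquiv_bal G k lam κ))
  exact (Equiv.subtypeEquivRight (fun κ => and_comm)).trans
    (Equiv.subtypeSubtypeEquivSubtypeInter _ _).symm

open Classical in
theorem aux_card2 {V : Type*} [Fintype V] (G : SimpleGraph V) (k : ℕ) (lam : ℕ) :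
    Nat.card {κ : V → ℕ+ // IsKBalancedColoring G k κ ∧ Function.Injective κ ∧
        ∀ v, (κ v : ℕ) ≤ lam} =
    (Finset.univ.filter fun f : V → Fin lam => AuxBal G k f ∧ Function.Injective f).card := by
  rw [← Fintype.card_subtype, ← Nat.card_eq_fintype_card]
  apply Nat.card_congr
  refine Equiv.trans ?_ (Equiv.subtypeEquiv (auxEquiv lam) (fun κ => 
    and_congr (auxEquiv_bal G k lam κ) (auxEquiv_inj lam κ)))
  exact (Equiv.subtypeEquivRight (fun κ => by tauto)).trans
    (Equiv.subtypeSubtypeEquivSubtypeInter (fun κ : V → ℕ+ => ∀ v, (κ v : ℕ) ≤ lam)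
      (fun κ => IsKBalancedColoring G k κ ∧ Function.Injective κ)).symm

open Classical in
theorem aux_inj_card {V : Type*} [Fintype V] (lam : ℕ) :
    (Finset.univ.filter fun f : V → Fin lam => Function.Injective f).card =
      lam.descFactorial (Fintype.card V) := by
  rw [← Fintype.card_subtype, Fintype.card_congr (Equiv.subtypeInjectiveEquivEmbedding _ _),
    Fintype.card_embedding_eq, Fintype.card_fin]

open Classical in
theorem aux_count {V : Type*} [Fintype V] (G : SimpleGraph V) (k : ℕ) (lam : ℕ) :
    (Finset.univ.filter fun f : V → Fin lam => AuxBal G k f ∧ Function.Injective f).card =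
    lam.choose (Fintype.card V) * (Finset.univ.filter fun f : V → Fin (Fintype.card V) =>
      AuxBal G k f ∧ Function.Injective f).card := by
  have h1 : lam.choose (Fintype.card V) =
      ((Finset.univ : Finset (Fin lam)).powersetCard (Fintype.card V)).attach.card := by simp
  rw [h1, ← Finset.card_product]
  symm
  refine Finset.card_bij (fun x _ => fun v => x.1.1.orderEmbOfFin
    (Finset.mem_powersetCard.1 x.1.2).2 (x.2 v)) ?_ ?_ ?_
  · rintro ⟨S, g⟩ hx
    simp only [Finset.mem_product, Finset.mem_filter, Finset.mem_univ, true_and] at hx ⊢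
    refine ⟨aux_bal_congr G k g _ (fun i j _ hij => ?_) hx.2.1, fun a b hab => hx.2.2 ?_⟩
    · exact (OrderEmbedding.lt_iff_lt _).2 hij
    · exact (RelEmbedding.injective _) hab
  · rintro ⟨⟨S, hS⟩, g⟩ hx ⟨⟨T, hT⟩, g'⟩ hx' heq
    simp only [Finset.mem_product, Finset.mem_filter, Finset.mem_univ, true_and] at hx hx' heq
    have rng : ∀ (S : Finset (Fin lam)) (hS : S.card = Fintype.card V)
        (g : V → Fin (Fintype.card V)), Function.Injective g →
        Set.range (fun v => S.orderEmbOfFin hS (g v)) = (S : Set (Fin lam)) := by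
      intro S hS g hg
      have hb : Function.Bijective g := (Fintype.bijective_iff_injective_and_card g).2
        ⟨hg, by simp⟩
      rw [← Finset.range_orderEmbOfFin S hS]
      exact hb.2.range_comp (S.orderEmbOfFin hS)
    have hST : S = T := by
      have a := rng S (Finset.mem_powersetCard.1 hS).2 g hx.2.2
      have b := rng T (Finset.mem_powersetCard.1 hT).2 g' hx'.2.2
      rw [heq] at a
      exact Finset.coe_injective (a.symm.trans b)
    subst hST
    have : g = g' := by
      funext v
      exact (RelEmbedding.injective _) (congrFun heq v)
    rw [this]
  · intro f hf
    simp only [Finset.mem_filter, Finset.mem_univ, true_and] at hf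
    obtain ⟨g, hg, hlt, hS, hk⟩ := aux_compress f hf.2
    refine ⟨(⟨Finset.univ.image f, Finset.mem_powersetCard.2 ⟨Finset.subset_univ _, ?_⟩⟩, g), ?_, ?_⟩
    · convert hS
    · simp only [Finset.mem_product, Finset.mem_filter, Finset.mem_univ, true_and,
        Finset.mem_attach]
      exact ⟨aux_bal_congr G k f g (fun i j _ => (hlt i j).2) hf.1, hg⟩
    · funext v
      exact hk v

open Filter Topology in
theorem aux_poly (p : Polynomial ℚ) (n c : ℕ) (hc : 0 < c)
    (h1 : ∀ l : ℕ, 0 < l → (l.choose n * c : ℚ) ≤ p.eval (l : ℚ))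
    (h2 : ∀ l : ℕ, 0 < l → p.eval (l : ℚ) ≤ l.choose n * c + ((l : ℚ) ^ n - l.descFactorial n)) :
    p.degree = (n : ℕ) ∧ p.leadingCoeff = (c : ℚ) / n.factorial := by
  have hD : Tendsto (fun l : ℕ => (l.descFactorial n : ℚ) / (l : ℚ) ^ n) atTop (𝓝 1) := by
    have hdeg : (descPochhammer ℚ n).degree = (Polynomial.X ^ n : Polynomial ℚ).degree := by
      rw [Polynomial.degree_X_pow, Polynomial.degree_eq_natDegree
        (monic_descPochhammer ℚ n).ne_zero, descPochhammer_natDegree]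
    have := Polynomial.div_tendsto_atTop_leadingCoeff_div_of_degree_eq _ _ hdeg
    rw [(monic_descPochhammer ℚ n).leadingCoeff, Polynomial.leadingCoeff_X_pow, div_one] at this
    have := this.comp (tendsto_natCast_atTop_atTop (R := ℚ))
    refine this.congr (fun l => ?_)
    simp [descPochhammer_eval_eq_descFactorial]
  have hfac : (n.factorial : ℚ) ≠ 0 := by exact_mod_cast n.factorial_ne_zero
  have hch : ∀ l : ℕ, (l.choose n : ℚ) = l.descFactorial n / n.factorial := by
    intro l
    rw [Nat.descFactorial_eq_factorial_mul_choose]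
    push_cast
    field_simp
  have hlim : Tendsto (fun l : ℕ => p.eval (l : ℚ) / (l : ℚ) ^ n) atTop
      (𝓝 ((c : ℚ) / n.factorial)) := by
    have lo : Tendsto (fun l : ℕ => (c : ℚ) / n.factorial *
      ((l.descFactorial n : ℚ) / (l : ℚ) ^ n)) atTop (𝓝 ((c : ℚ) / n.factorial)) := by
      simpa using hD.const_mul ((c : ℚ) / n.factorial)
    have hi : Tendsto (fun l : ℕ => (c : ℚ) / n.factorial *
      ((l.descFactorial n : ℚ) / (l : ℚ) ^ n) + (1 - (l.descFactorial n : ℚ) / (l : ℚ) ^ n))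
      atTop (𝓝 ((c : ℚ) / n.factorial)) := by
      simpa using lo.add (hD.const_sub 1)
    refine tendsto_of_tendsto_of_tendsto_of_le_of_le' lo hi ?_ ?_
    · filter_upwards [eventually_gt_atTop 0] with l hl
      have hl' : (0 : ℚ) < (l : ℚ) ^ n := by positivity
      rw [le_div_iff₀ hl']
      refine le_trans (le_of_eq ?_) (h1 l hl)
      rw [hch]
      field_simp
    · filter_upwards [eventually_gt_atTop 0] with l hl
      have hl' : (0 : ℚ) < (l : ℚ) ^ n := by positivity
      rw [div_le_iff₀ hl']
      refine le_trans (h2 l hl) (le_of_eq ?_)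
      rw [hch]
      field_simp
  have hpos : (0 : ℚ) < (c : ℚ) / n.factorial := by positivity
  have hdX : (Polynomial.X ^ n : Polynomial ℚ).degree = n := Polynomial.degree_X_pow n
  rcases lt_trichotomy p.degree (n : WithBot ℕ) with h | h | h
  · exfalso
    have := (Polynomial.div_tendsto_atTop_zero_of_degree_lt p (Polynomial.X ^ n)
      (by rw [hdX]; exact h)).comp (tendsto_natCast_atTop_atTop (R := ℚ))
    have := this.congr (f₂ := fun l : ℕ => p.eval (l : ℚ) / (l : ℚ) ^ n) (fun l => by simp)
    exact hpos.ne (tendsto_nhds_unique this hlim)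
  · refine ⟨h, ?_⟩
    have := (Polynomial.div_tendsto_atTop_leadingCoeff_div_of_degree_eq p (Polynomial.X ^ n)
      (by rw [hdX]; exact h)).comp (tendsto_natCast_atTop_atTop (R := ℚ))
    have := this.congr (f₂ := fun l : ℕ => p.eval (l : ℚ) / (l : ℚ) ^ n) (fun l => by simp)
    simpa using tendsto_nhds_unique this hlim
  · exfalso
    have := (Polynomial.abs_div_tendsto_atTop_atTop_of_degree_gt p (Polynomial.X ^ n)
      (by rw [hdX]; exact h) (by simp)).comp (tendsto_natCast_atTop_atTop (R := ℚ))
    have := this.congr (f₂ := fun l : ℕ => |p.eval (l : ℚ) / (l : ℚ) ^ n|) (fun l => by simp)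
    exact not_tendsto_nhds_of_tendsto_atTop this _ hlim.abs

/-- Suppose `k ≥ 2`, `G` has `n` vertices, contains a cycle, and admits a
`k`-balanced coloring, and let `p` be the polynomial with `p(λ) = χ_G^k(λ)` for all positive
integers `λ`.  Then `deg p = n` and the leading coefficient of `p` is `c/n!`, where `c` is
the number of `k`-balanced colorings of `G` that are bijections onto `{1,…,n}`; moreover
`0 < c < n!`, so the leading coefficient is not an integer. -/
theorem stmt12 {V : Type*} [Fintype V] (G : SimpleGraph V) (k : ℕ) (hk : 2 ≤ k)
    (hcyc : ∃ (v : V) (c : G.Walk v v), c.IsCycle)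
    (hbal : ∃ κ : V → ℕ+, IsKBalancedColoring G k κ)
    (p : Polynomial ℚ)
    (hp : ∀ lam : ℕ, 0 < lam → p.eval (lam : ℚ) = kChromCount G k lam) :
    p.degree = (Fintype.card V : ℕ) ∧
    p.leadingCoeff =
      (Nat.card {κ : V → ℕ+ // IsKBalancedColoring G k κ ∧ Function.Injective κ ∧
        ∀ v, (κ v : ℕ) ≤ Fintype.card V} : ℚ) / (Fintype.card V).factorial ∧
    0 < Nat.card {κ : V → ℕ+ // IsKBalancedColoring G k κ ∧ Function.Injective κ ∧
        ∀ v, (κ v : ℕ) ≤ Fintype.card V} ∧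
    Nat.card {κ : V → ℕ+ // IsKBalancedColoring G k κ ∧ Function.Injective κ ∧
        ∀ v, (κ v : ℕ) ≤ Fintype.card V} < (Fintype.card V).factorial ∧
    ¬ ∃ z : ℤ, p.leadingCoeff = (z : ℚ) := by
  classical
  rw [aux_card2]
  set c := (Finset.univ.filter fun f : V → Fin (Fintype.card V) =>
      AuxBal G k f ∧ Function.Injective f).card with hc
  have hc0 : 0 < c := by
    obtain ⟨κ, hκ⟩ := hbal
    obtain ⟨f, hf, hlt⟩ := aux_linext κ
    rw [hc, Finset.card_pos]
    refine ⟨f, ?_⟩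
    simp only [Finset.mem_filter, Finset.mem_univ, true_and]
    exact ⟨aux_bal_congr G k κ f (fun i j _ => hlt i j) hκ, hf⟩
  have hc1 : c < (Fintype.card V).factorial := by
    rw [← Nat.descFactorial_self, ← aux_inj_card, hc]
    apply Finset.card_lt_card
    obtain ⟨f, hf, hn⟩ := aux_nonbal G k hk hcyc
    rw [Finset.ssubset_iff_of_subset (fun g hg => by
      simp only [Finset.mem_filter, Finset.mem_univ, true_and] at hg ⊢
      exact hg.2)]
    refine ⟨f, by simpa using hf, ?_⟩
    simp [hn]
  have key : ∀ l : ℕ, (kChromCount G k l : ℚ) =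
      l.choose (Fintype.card V) * c + (Finset.univ.filter fun f : V → Fin l =>
        AuxBal G k f ∧ ¬ Function.Injective f).card := by
    intro l
    rw [aux_card1, hc]
    norm_cast
    rw [← aux_count, ← Finset.filter_filter, ← Finset.filter_filter,
      Finset.card_filter_add_card_filter_not]
  have key2 : ∀ l : ℕ, (((Finset.univ.filter fun f : V → Fin l =>
        AuxBal G k f ∧ ¬ Function.Injective f).card : ℕ) : ℚ) ≤
      (l : ℚ) ^ (Fintype.card V) - l.descFactorial (Fintype.card V) := by
    intro l
    rw [le_sub_iff_add_le, ← aux_inj_card (V := V) l]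
    have h1 : (Finset.univ.filter fun f : V → Fin l =>
        AuxBal G k f ∧ ¬ Function.Injective f).card ≤ (Finset.univ.filter fun f : V → Fin l =>
        ¬ Function.Injective f).card := by
      apply Finset.card_le_card
      intro g hg
      simp only [Finset.mem_filter, Finset.mem_univ, true_and] at hg ⊢
      exact hg.2
    have h2 := Finset.card_filter_add_card_filter_not (s := Finset.univ)
      (fun f : V → Fin l => Function.Injective f)
    rw [Finset.card_univ, Fintype.card_fun, Fintype.card_fin] at h2
    norm_cast
    omega
  obtain ⟨hd, hl⟩ := aux_poly p (Fintype.card V) c hc0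
    (fun l hl => by
      rw [hp l hl, key]
      exact le_add_of_nonneg_right (Nat.cast_nonneg _))
    (fun l hl => by
      rw [hp l hl, key]
      exact add_le_add_right (key2 l) _)
  refine ⟨hd, hl, hc0, hc1, ?_⟩
  rintro ⟨z, hz⟩
  rw [hl] at hz
  have hF : (0 : ℚ) < (Fintype.card V).factorial := by
    exact_mod_cast (Fintype.card V).factorial_pos
  have z0 : (0 : ℚ) < z := by
    rw [← hz]
    exact div_pos (by exact_mod_cast hc0) hF
  have z1 : (z : ℚ) < 1 := by
    rw [← hz, div_lt_one hF]
    exact_mod_cast hc1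
  have z0' : 0 < z := by exact_mod_cast z0
  have z1' : z < 1 := by exact_mod_cast z1
  omega
end
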